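/- arXiv:2207.04961 — 4 statements merged into one kernel-verified Lean document; each statement's English description precedes it below -/
import Mathlib

section
/- Let X be a set, let n ≥ 1 be an integer, let κ be an infinite cardinal, and let A ⊆ X^n be a set with n-cardinality |A|_n ≥ κ. Then A contains a subset B of cardinality κ such that the coordinate sets of distinct points of B are disjoint, i.e., p̃ ∩ q̃ = ∅ whenever p and q are distinct points of B. (This is the forward direction of Lemma 1.) -/
open Cardinal Set Topology

universe u

/-- The `n`-cardinality `|A|ₙ` of a set `A ⊆ Xⁿ` with respect to `X`: the least cardinal `κ`
such that there is `Y ⊆ X` with `#Y = κ` and every point of `A` has a coordinate in `Y`. -/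
noncomputable def nCardinality {X : Type u} (n : ℕ) (A : Set (Fin n → X)) : Cardinal.{u} :=
  sInf {κ : Cardinal.{u} | ∃ Y : Set X, #Y = κ ∧ ∀ p ∈ A, ∃ i, p i ∈ Y}

/-- A set covering `A` coordinatewise has at least `nCardinality n A` elements. -/
theorem nCardinality_le_mk {X : Type u} {n : ℕ} {A : Set (Fin n → X)} (Y : Set X)
    (hY : ∀ p ∈ A, ∃ i, p i ∈ Y) : nCardinality n A ≤ #Y :=
  csInf_le' ⟨Y, rfl, hY⟩

/-- Every set has a maximal subset on which a family of sets is pairwise disjoint. -/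
theorem exists_maximal_pairwiseDisjoint {ι α : Type*} (f : ι → Set α) (A : Set ι) :
    ∃ M, Maximal (fun s : Set ι => s ⊆ A ∧ s.PairwiseDisjoint f) M :=
  zorn_subset {s | s ⊆ A ∧ s.PairwiseDisjoint f} fun c hc hchain =>
    ⟨⋃₀ c, ⟨sUnion_subset fun _ hs => (hc hs).1,
      (pairwiseDisjoint_sUnion hchain.directedOn).2 fun _ hs => (hc hs).2⟩,
      fun _ hs => subset_sUnion_of_mem hs⟩

/-- The union of fewer than `κ` coordinate sets has fewer than `κ` elements, for `κ` infinite. -/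
theorem mk_biUnion_range_lt {X : Type u} {n : ℕ} {κ : Cardinal.{u}} (hκ : ℵ₀ ≤ κ)
    {M : Set (Fin n → X)} (hM : #M < κ) : #(⋃ p ∈ M, range p) < κ := by
  have hsub : (⋃ p ∈ M, range p) ⊆ range fun x : M × ULift.{u} (Fin n) => x.1.1 x.2.down := by
    simp only [iUnion_subset_iff]
    rintro p hp _ ⟨i, rfl⟩
    exact ⟨(⟨p, hp⟩, ⟨i⟩), rfl⟩
  refine ((mk_le_mk_of_subset hsub).trans mk_range_le).trans_lt ?_
  rw [mk_prod, lift_id, lift_id]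
  exact mul_lt_of_lt hκ hM ((lt_aleph0_of_finite _).trans_le hκ)

/-- Forward direction of Lemma 1: if `|A|ₙ ≥ κ` with `κ` infinite, then `A` contains a set `B`
of cardinality `κ` whose distinct points have disjoint coordinate sets. -/
theorem nCardinality_ge_imp_exists_disjoint_family {X : Type u} (n : ℕ) (hn : 1 ≤ n)
    (κ : Cardinal.{u}) (hκ : aleph0 ≤ κ) (A : Set (Fin n → X))
    (hA : κ ≤ nCardinality n A) :
    ∃ B : Set (Fin n → X), B ⊆ A ∧ #B = κ ∧
      ∀ p ∈ B, ∀ q ∈ B, p ≠ q → Disjoint (range p) (range q) := by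
  obtain ⟨M, ⟨hMA, hMd⟩, hMmax⟩ := exists_maximal_pairwiseDisjoint (fun p : Fin n → X => range p) A
  have hcover : ∀ p ∈ A, ∃ i, p i ∈ ⋃ q ∈ M, range q := by
    intro p hp
    by_contra! h
    have hins : insert p M ⊆ A ∧ (insert p M).PairwiseDisjoint fun p : Fin n → X => range p := by
      refine ⟨insert_subset hp hMA, hMd.insert fun q hq _ => ?_⟩
      rw [Set.disjoint_left]
      rintro _ ⟨i, rfl⟩ hi
      exact h i (mem_biUnion hq hi)
    exact h ⟨0, hn⟩ (mem_biUnion (hMmax hins (subset_insert p M) (mem_insert p M)) (mem_range_self _))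
  have hκM : κ ≤ #M := by
    by_contra! hlt
    exact ((hA.trans (nCardinality_le_mk _ hcover)).trans_lt (mk_biUnion_range_lt hκ hlt)).false
  obtain ⟨B, hBM, hB⟩ := le_mk_iff_exists_subset.1 hκM
  exact ⟨B, hBM.trans hMA, hB, fun p hp q hq hpq => hMd (hBM hp) (hBM hq) hpq⟩
end

section
/- Let X be a set, let n ≥ 1 be an integer, let κ be an infinite cardinal, and let A ⊆ X^n. If A contains a subset B of cardinality κ such that p̃ ∩ q̃ = ∅ whenever p and q are distinct points of B, then the n-cardinality of A satisfies |A|_n ≥ κ. (This is the converse direction of Lemma 1.) -/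
open Cardinal Set Topology

universe u

/-- Converse direction of Lemma 1: if `A` contains a set `B` of infinite cardinality `κ`
whose distinct points have disjoint coordinate sets, then `|A|ₙ ≥ κ`. -/
theorem le_nCardinality_of_disjoint_family {X : Type u} (n : ℕ) (hn : 1 ≤ n)
    (κ : Cardinal.{u}) (hκ : aleph0 ≤ κ) (A B : Set (Fin n → X)) (hBA : B ⊆ A)
    (hB : #B = κ)
    (hdisj : ∀ p ∈ B, ∀ q ∈ B, p ≠ q → Disjoint (range p) (range q)) :
    κ ≤ nCardinality n A := by
  refine le_csInf ⟨_, univ, rfl, fun p _ => ⟨⟨0, hn⟩, mem_univ _⟩⟩ ?_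
  rintro _ ⟨Y, rfl, hY⟩
  choose i hi using hY
  rw [← hB]
  refine mk_le_of_injective
    (f := fun p : B => (⟨p.1 (i p.1 (hBA p.2)), hi p.1 (hBA p.2)⟩ : Y)) ?_
  intro p q hpq
  by_contra hne
  refine disjoint_left.1 (hdisj p.1 p.2 q.1 q.2 fun h => hne (Subtype.ext h))
    (mem_range_self (i p.1 (hBA p.2))) ?_
  exact ⟨_, (congrArg Subtype.val hpq).symm⟩
end

section
/- Let X be a set, let (n(α))_{α < 2^ℵ₀} be a family of positive integers, and for each ordinal α < 2^ℵ₀ let A_α ⊆ X^{n(α)} be a set with n(α)-cardinality |A_α|_{n(α)} ≥ 2^ℵ₀. Then one can choose points p(α, i) ∈ A_α for all α < 2^ℵ₀ and all i ∈ ℕ such that the coordinate sets are pairwise disjoint: p̃(α, i) ∩ p̃(β, j) = ∅ whenever (α, i) ≠ (β, j). (This is the transfinite selection at the core of the proof of Theorem 1.) -/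
open Cardinal Set Topology

universe u

/-- A set of cardinality less than `|A|ₙ` is avoided by all coordinates of some point of `A`. -/
theorem exists_disjoint_range_of_lt_nCardinality {X : Type u} {n : ℕ} {A : Set (Fin n → X)}
    {Y : Set X} (hY : #Y < nCardinality n A) : ∃ p ∈ A, Disjoint (range p) Y := by
  by_contra! h
  refine hY.not_ge (csInf_le' ⟨Y, rfl, fun p hp => ?_⟩)
  obtain ⟨_, ⟨i, rfl⟩, hi⟩ := Set.not_disjoint_iff.1 (h p hp)
  exact ⟨i, hi⟩

/-- Transfinite selection along a well-order with initial segments of cardinality less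
than `κ`. -/
theorem exists_pairwise_disjoint_of_forall_mk_lt {S : Type*} {K X : Type u} [LinearOrder K]
    [WellFoundedLT K] (e : S ≃ K) {κ : Cardinal.{u}} (hκ : ℵ₀ < κ)
    (hK : ∀ k : K, #(Iio k) < κ) {T : S → Type*} (P : ∀ s, Set (T s)) (r : ∀ s, T s → Set X)
    (hr : ∀ s t, (r s t).Countable)
    (h : ∀ s (Y : Set X), #Y < κ → ∃ t ∈ P s, Disjoint (r s t) Y) :
    ∃ f : ∀ s, T s, (∀ s, f s ∈ P s) ∧
      Pairwise fun s s' => Disjoint (r s (f s)) (r s' (f s')) := by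
  have h' : ∀ s (Y : Set X), ∃ t, #Y < κ → t ∈ P s ∧ Disjoint (r s t) Y := by
    intro s Y
    by_cases hY : #Y < κ
    · obtain ⟨t, ht⟩ := h s Y hY
      exact ⟨t, fun _ => ht⟩
    · obtain ⟨t, -⟩ := h s ∅ (by simpa using hκ.pos)
      exact ⟨t, fun hY' => absurd hY' hY⟩
  choose g hg using h'
  have wf : WellFounded (InvImage (· < ·) e) := InvImage.wf e wellFounded_lt
  let F : ∀ s, (∀ s', InvImage (· < ·) e s' s → T s') → T s := fun s ih =>
    g s (⋃ k : Iio (e s), r _ (ih (e.symm k) ((e.apply_symm_apply k.1).trans_lt k.2)))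
  let f : ∀ s, T s := wf.fix F
  have hf (s : S) : f s = g s (⋃ k : Iio (e s), r _ (f (e.symm k))) := wf.fix_eq F s
  have hcard (s : S) : #(⋃ k : Iio (e s), r _ (f (e.symm k)) : Set X) < κ := by
    refine (mk_iUnion_le_sum_mk.trans (sum_le_sum _ (fun _ => ℵ₀) fun k => ?_)).trans_lt ?_
    · exact (hr _ _).le_aleph0
    · simpa using mul_lt_of_lt hκ.le (hK (e s)) hκ
  have hspec (s : S) := hg s _ (hcard s)
  have hlt (s s' : S) (hs : e s' < e s) : Disjoint (r s (f s)) (r s' (f s')) := by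
    have hd := (hspec s).2
    rw [← hf] at hd
    refine hd.mono_right ?_
    obtain ⟨k, rfl⟩ := e.symm.surjective s'
    exact subset_iUnion (fun k : Iio (e s) => r _ (f (e.symm k)))
      ⟨k, (e.apply_symm_apply k).symm.trans_lt hs⟩
  refine ⟨f, fun s => ?_, fun s s' hne => ?_⟩
  · rw [hf]
    exact (hspec s).1
  · rcases lt_or_gt_of_ne (e.injective.ne hne) with hs | hs
    · exact (hlt _ _ hs).symm
    · exact hlt _ _ hs

theorem mk_subtype_lt_ord_continuum_prod_nat :
    #({o : Ordinal.{u} // o < Cardinal.continuum.{u}.ord} × ℕ) = continuum := by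
  have h : #{o : Ordinal.{u} // o < Cardinal.continuum.{u}.ord} = continuum :=
    (Cardinal.mk_Iio_ordinal Cardinal.continuum.{u}.ord).trans (by simp)
  simp [h]

/-- The transfinite selection at the core of the proof of Theorem 1: given, for each ordinal
`α < 2^ℵ₀`, a positive integer `n α` and a set `Aₐ ⊆ X^{n α}` with `|Aₐ|_{n α} ≥ 2^ℵ₀`, one
can choose points `p α i ∈ Aₐ` (for `α < 2^ℵ₀`, `i ∈ ℕ`) whose coordinate sets are pairwise
disjoint. -/
theorem exists_selection_pairwise_disjoint_coords {X : Type u}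
    (n : {o : Ordinal.{u} // o < Cardinal.continuum.{u}.ord} → ℕ)
    (hn : ∀ α, 1 ≤ n α)
    (A : ∀ α, Set (Fin (n α) → X))
    (hA : ∀ α, continuum ≤ nCardinality (n α) (A α)) :
    ∃ p : ∀ α, ℕ → (Fin (n α) → X),
      (∀ α i, p α i ∈ A α) ∧
      ∀ α i β j, (α ≠ β ∨ i ≠ j) →
        Disjoint (range (p α i)) (range (p β j)) := by
  obtain ⟨e⟩ : Nonempty ({o : Ordinal.{u} // o < Cardinal.continuum.{u}.ord} × ℕ ≃
      Cardinal.continuum.{u}.ord.ToType) := by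
    rw [← Cardinal.lift_mk_eq', mk_subtype_lt_ord_continuum_prod_nat]
    simp
  obtain ⟨f, hfA, hf⟩ := exists_pairwise_disjoint_of_forall_mk_lt e aleph0_lt_continuum
    (fun k => (mk_Iio_lt k (by simp)).trans_eq (by simp)) (T := fun s => Fin (n s.1) → X) (fun s => A s.1)
    (fun _ p => range p) (fun _ p => countable_range p)
    (fun s Y hY => exists_disjoint_range_of_lt_nCardinality (hY.trans_le (hA s.1)))
  refine ⟨fun α i => f (α, i), fun α i => hfA (α, i), fun α i β j hne => hf ?_⟩
  rwa [Ne, Prod.mk.injEq, not_and_or]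
end

section
/- Let (X, τ) be a separable completely metrizable (Polish) topological space, let n ≥ 1 be an integer, and let A ⊆ Xⁿ be a set that is closed in the product topology and n-uncountable (|A|_n > ℵ₀). Then |A|_n ≥ 2^ℵ₀. (This fact about Polish spaces is used at the beginning of the proof of Theorem 1.) -/
open Cardinal Set Topology

universe u

/-- Every neighborhood of a point in a metric space contains a closed neighborhood of small
diameter. -/
theorem exists_isClosed_mem_nhds_subset_ediam_le {Z : Type*} [MetricSpace Z] {W : Set Z} {x : Z}
    (hW : W ∈ 𝓝 x) {ε : ENNReal} (hε : 0 < ε) :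
    ∃ D ∈ 𝓝 x, IsClosed D ∧ D ⊆ W ∧ Metric.ediam D ≤ ε := by
  have hε2 : 0 < ε / 2 := ENNReal.div_pos hε.ne' (by simp)
  obtain ⟨D, hD, hDc, hDW⟩ := exists_mem_nhds_isClosed_subset
    (Filter.inter_mem hW (Metric.isOpen_eball.mem_nhds (Metric.mem_eball_self hε2)))
  refine ⟨D, hD, hDc, hDW.trans inter_subset_left, ?_⟩
  calc Metric.ediam D ≤ 2 * (ε / 2) :=
        (Metric.ediam_mono (hDW.trans inter_subset_right)).trans Metric.ediam_eball_le
    _ = ε := ENNReal.mul_div_cancel (by simp) (by simp)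

/-- An open relation meeting the square of every nonempty open set relates all pairs of points
of some pair of small closed subsets with nonempty interior of any given set with nonempty
interior. -/
theorem exists_small_splitting_of_isOpen {Z : Type*} [MetricSpace Z] {R : Set (Z × Z)}
    (hR : IsOpen R)
    (hdense : ∀ U : Set Z, IsOpen U → U.Nonempty → ∃ p ∈ U, ∃ q ∈ U, (p, q) ∈ R)
    {C : Set Z} (hC : (interior C).Nonempty) {ε : ENNReal} (hε : 0 < ε) :
    ∃ C₀ C₁ : Set Z, (IsClosed C₀ ∧ (interior C₀).Nonempty ∧ C₀ ⊆ C ∧ Metric.ediam C₀ ≤ ε) ∧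
      (IsClosed C₁ ∧ (interior C₁).Nonempty ∧ C₁ ⊆ C ∧ Metric.ediam C₁ ≤ ε) ∧
      C₀ ×ˢ C₁ ⊆ R := by
  obtain ⟨p, hp, q, hq, hpq⟩ := hdense _ isOpen_interior hC
  obtain ⟨U, hU, V, hV, hUV⟩ := mem_nhds_prod_iff.1 (hR.mem_nhds hpq)
  obtain ⟨C₀, hp₀, hc₀, hs₀, hd₀⟩ := exists_isClosed_mem_nhds_subset_ediam_le
    (Filter.inter_mem hU (mem_interior_iff_mem_nhds.1 hp)) hε
  obtain ⟨C₁, hq₁, hc₁, hs₁, hd₁⟩ := exists_isClosed_mem_nhds_subset_ediam_le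
    (Filter.inter_mem hV (mem_interior_iff_mem_nhds.1 hq)) hε
  exact ⟨C₀, C₁,
    ⟨hc₀, ⟨p, mem_interior_iff_mem_nhds.2 hp₀⟩, hs₀.trans inter_subset_right, hd₀⟩,
    ⟨hc₁, ⟨q, mem_interior_iff_mem_nhds.2 hq₁⟩, hs₁.trans inter_subset_right, hd₁⟩,
    (prod_mono (hs₀.trans inter_subset_left) (hs₁.trans inter_subset_left)).trans hUV⟩

open CantorScheme in
/-- A symmetric open relation on a nonempty Polish space that meets the square of every nonempty
open set admits a family of pairwise related points indexed by the Cantor space. -/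
theorem exists_nat_bool_pairwise_of_isOpen {Z : Type*} [TopologicalSpace Z] [PolishSpace Z]
    [Nonempty Z] {R : Set (Z × Z)} (hR : IsOpen R) (hsymm : ∀ p q, (p, q) ∈ R → (q, p) ∈ R)
    (hdense : ∀ U : Set Z, IsOpen U → U.Nonempty → ∃ p ∈ U, ∃ q ∈ U, (p, q) ∈ R) :
    ∃ f : (ℕ → Bool) → Z, Pairwise fun x y => (f x, f y) ∈ R := by
  let := TopologicalSpace.upgradeIsCompletelyMetrizable Z
  obtain ⟨u, -, upos', hu⟩ := exists_seq_strictAnti_tendsto' (zero_lt_one' ENNReal)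
  have upos := fun n => (upos' n).1
  let P := Subtype fun E : Set Z => IsClosed E ∧ (interior E).Nonempty
  choose C₀ C₁ h₀ h₁ hrel using
    fun {C : Set Z} (hC : (interior C).Nonempty) {ε : ENNReal} (hε : 0 < ε) =>
    exists_small_splitting_of_isOpen hR hdense hC hε
  let DP : List Bool → P := fun l => by
    induction l with
    | nil => exact ⟨univ, isClosed_univ, by simp⟩
    | cons a l ih =>
      cases a
      · exact ⟨C₀ ih.property.2 (upos (l.length + 1)), (h₀ _ _).1, (h₀ _ _).2.1⟩
      · exact ⟨C₁ ih.property.2 (upos (l.length + 1)), (h₁ _ _).1, (h₁ _ _).2.1⟩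
  let D : List Bool → Set Z := fun l => (DP l).val
  have hanti : ClosureAntitone D := by
    refine Antitone.closureAntitone ?_ fun l => (DP l).property.1
    rintro l (_ | _)
    · exact (h₀ _ _).2.2.1
    · exact (h₁ _ _).2.2.1
  have hdiam : VanishingDiam D := by
    intro x
    refine tendsto_of_tendsto_of_tendsto_of_le_of_le' tendsto_const_nhds hu (by simp) ?_
    rw [Filter.eventually_atTop]
    refine ⟨1, fun m (hm : 1 ≤ m) => ?_⟩
    obtain ⟨n, rfl⟩ := Nat.exists_eq_succ_of_ne_zero (Nat.one_le_iff_ne_zero.1 hm)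
    dsimp
    cases x n
    · convert! (h₀ _ _).2.2.2
      rw [PiNat.res_length]
    · convert! (h₁ _ _).2.2.2
      rw [PiNat.res_length]
  have hsplit : ∀ l, D (false :: l) ×ˢ D (true :: l) ⊆ R := fun l => hrel _ _
  have hdom : ∀ x : ℕ → Bool, x ∈ (inducedMap D).1 := fun x => by
    rw [hanti.map_of_vanishingDiam hdiam fun l => (DP l).property.2.mono interior_subset]
    apply mem_univ
  refine ⟨fun x => (inducedMap D).2 ⟨x, hdom x⟩, fun x y hxy => ?_⟩
  have hne : ∃ n, x n ≠ y n := Function.ne_iff.1 hxy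
  classical
  obtain ⟨n, hn, hmin⟩ : ∃ n, x n ≠ y n ∧ PiNat.res x n = PiNat.res y n :=
    ⟨Nat.find hne, Nat.find_spec hne,
      PiNat.res_eq_res.2 fun m hm => not_not.1 (Nat.find_min hne hm)⟩
  have hx := map_mem (A := D) ⟨x, hdom x⟩ (n + 1)
  have hy := map_mem (A := D) ⟨y, hdom y⟩ (n + 1)
  rw [PiNat.res_succ] at hx hy
  dsimp only at hx hy
  rw [← hmin] at hy
  cases hxn : x n <;> cases hyn : y n <;> rw [hxn] at hx <;> rw [hyn] at hy
  · exact absurd (hxn.trans hyn.symm) hn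
  · exact hsplit _ ⟨hx, hy⟩
  · exact hsymm _ _ (hsplit _ ⟨hy, hx⟩)
  · exact absurd (hxn.trans hyn.symm) hn

/-- A set of `n`-tuples that cannot be covered by a countable set of coordinates contains a closed
kernel, all of whose nonempty relatively open subsets have the same property. -/
theorem exists_isClosed_kernel_of_not_countable_hitting {ι X : Type*} [TopologicalSpace (ι → X)]
    [SecondCountableTopology (ι → X)] {A : Set (ι → X)} (hA : IsClosed A)
    (hunc : ¬ ∃ Y : Set X, Y.Countable ∧ ∀ p ∈ A, ∃ i, p i ∈ Y) :
    ∃ K ⊆ A, IsClosed K ∧ K.Nonempty ∧ ∀ U, IsOpen U → (K ∩ U).Nonempty →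
      ¬ ∃ Y : Set X, Y.Countable ∧ ∀ p ∈ K ∩ U, ∃ i, p i ∈ Y := by
  let S : Set (Set (ι → X)) := {b ∈ TopologicalSpace.countableBasis (ι → X) |
    ∃ Y : Set X, Y.Countable ∧ ∀ p ∈ A ∩ b, ∃ i, p i ∈ Y}
  have hS : S.Countable := (TopologicalSpace.countable_countableBasis _).mono (sep_subset _ _)
  have hSopen : IsOpen (⋃₀ S) :=
    isOpen_sUnion fun b hb => TopologicalSpace.isOpen_of_mem_countableBasis hb.1
  choose! Y hYc hY using fun b (hb : b ∈ S) => hb.2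
  have hN : (⋃ b ∈ S, Y b).Countable := hS.biUnion hYc
  have hNA : ∀ p ∈ A, p ∈ ⋃₀ S → ∃ i, p i ∈ ⋃ b ∈ S, Y b := by
    rintro p hp ⟨b, hb, hpb⟩
    obtain ⟨i, hi⟩ := hY b hb p ⟨hp, hpb⟩
    exact ⟨i, mem_biUnion hb hi⟩
  refine ⟨A \ ⋃₀ S, sdiff_subset, hA.sdiff hSopen, ?_, ?_⟩
  · by_contra hempty
    refine hunc ⟨_, hN, fun p hp => hNA p hp ?_⟩
    by_contra hpS
    exact hempty ⟨p, hp, hpS⟩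
  · rintro U hU ⟨p, ⟨hpA, hpS⟩, hpU⟩ ⟨T, hT, hTU⟩
    obtain ⟨b, hb, hpb, hbU⟩ :=
      (TopologicalSpace.isBasis_countableBasis _).exists_subset_of_mem_open hpU hU
    refine hpS ⟨b, ⟨hb, T ∪ ⋃ b ∈ S, Y b, hT.union hN, ?_⟩, hpb⟩
    rintro q ⟨hqA, hqb⟩
    by_cases hq : q ∈ ⋃₀ S
    · exact (hNA q hqA hq).imp fun i hi => Or.inr hi
    · exact (hTU q ⟨⟨hqA, hq⟩, hbU hqb⟩).imp fun i hi => Or.inl hi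

/-- In a Polish space `X`, every closed `n`-uncountable subset of `Xⁿ` (with the product
topology) has `n`-cardinality at least `2^ℵ₀`. -/
theorem continuum_le_nCardinality_of_isClosed {X : Type u} [TopologicalSpace X]
    [PolishSpace X] (n : ℕ) (hn : 1 ≤ n) (A : Set (Fin n → X)) (hclosed : IsClosed A)
    (hunc : aleph0 < nCardinality n A) :
    continuum ≤ nCardinality n A := by
  have hunc' : ¬ ∃ Y : Set X, Y.Countable ∧ ∀ p ∈ A, ∃ i, p i ∈ Y := by
    rintro ⟨Y, hY, hYA⟩
    have hle : nCardinality n A ≤ #Y := csInf_le' ⟨Y, rfl, hYA⟩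
    exact (hunc.trans_le hle).not_ge (mk_le_aleph0_iff.2 hY.to_subtype)
  obtain ⟨K, hKA, hK, hKne, hKunc⟩ :=
    exists_isClosed_kernel_of_not_countable_hitting hclosed hunc'
  have := hK.polishSpace
  have := hKne.to_subtype
  let R : Set (K × K) := {z | ∀ i j, z.1.1 i ≠ z.2.1 j}
  have hR : IsOpen R := by
    simp only [R, ofPred_forall]
    refine isOpen_iInter_of_finite fun i => isOpen_iInter_of_finite fun j => ?_
    exact isOpen_ne_fun
      ((continuous_apply i).comp (continuous_subtype_val.comp continuous_fst))
      ((continuous_apply j).comp (continuous_subtype_val.comp continuous_snd))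
  obtain ⟨f, hf⟩ := exists_nat_bool_pairwise_of_isOpen hR
    (fun p q hpq i j h => hpq j i h.symm) (by
      rintro U hU ⟨p, hp⟩
      obtain ⟨V, hV, rfl⟩ := isOpen_induced_iff.1 hU
      have hpV := hKunc V hV ⟨p, p.2, hp⟩
      push Not at hpV
      obtain ⟨q, ⟨hqK, hqV⟩, hq⟩ := hpV (range p.1) (countable_range _)
      exact ⟨p, hp, ⟨q, hqK⟩, hqV, fun i j h => hq j ⟨i, h⟩⟩)
  refine le_csInf ⟨_, univ, rfl, fun p _ => ⟨⟨0, hn⟩, mem_univ _⟩⟩ ?_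
  rintro _ ⟨Y, rfl, hY⟩
  choose c hc using fun x => hY (f x).1 (hKA (f x).2)
  have hinj : Function.Injective fun x => (⟨_, hc x⟩ : Y) := fun x y hxy => by
    by_contra hne
    exact hf hne _ _ (congrArg Subtype.val hxy)
  simpa using lift_mk_le_lift_mk_of_injective hinj
end
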